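/- arXiv:1812.05076 — 4 statements merged into one kernel-verified Lean document; each statement's English description precedes it below -/
import Mathlib

section
/- There exists a constant K (depending only on σ, b, T, the path m and x₀, but not on t or ε) such that |Y^ε_t| ≤ K and |X^ε_t| ≤ K for all t ∈ [0, T] and all ε > 0. -/
open intervalIntegral

/-- `Y : ℝ → ℝ` is a continuous solution on `[0, T]` of the (Doss–Sussmann transformed)
integral equation
`Y t = H (0, x₀) + ∫₀^t (∂H/∂x) (m s, F (m s, Y s)) · b (F (m s, Y s), s / ε) ds`. -/
def SolvesAveragingODE (F H : ℝ × ℝ → ℝ) (b : ℝ × ℝ → ℝ) (m : ℝ → ℝ)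
    (T x₀ ε : ℝ) (Y : ℝ → ℝ) : Prop :=
  ContinuousOn Y (Set.Icc 0 T) ∧
  ∀ t ∈ Set.Icc (0:ℝ) T,
    Y t = H (0, x₀) + ∫ s in (0:ℝ)..t,
      deriv (fun y : ℝ => H (m s, y)) (F (m s, Y s)) * b (F (m s, Y s), s / ε)

/-- Forward Grönwall estimate for two global solutions of an autonomous Lipschitz equation. -/
lemma dist_le_of_hasDerivAt_of_le {v f g : ℝ → ℝ} {K : NNReal} (hv : LipschitzWith K v)
    (hf : ∀ t, HasDerivAt f (v (f t)) t) (hg : ∀ t, HasDerivAt g (v (g t)) t)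
    {s t : ℝ} (hst : s ≤ t) :
    dist (f t) (g t) ≤ dist (f s) (g s) * Real.exp (K * (t - s)) :=
  dist_le_of_trajectories_ODE (v := fun _ => v) (a := s) (b := t) (fun _ => hv)
    (fun x _ => (hf x).continuousAt.continuousWithinAt) (fun x _ => (hf x).hasDerivWithinAt)
    (fun x _ => (hg x).continuousAt.continuousWithinAt) (fun x _ => (hg x).hasDerivWithinAt)
    le_rfl t (Set.right_mem_Icc.2 hst)

/-- Two-sided Grönwall estimate for two global solutions of an autonomous Lipschitz equation. -/
lemma dist_le_of_hasDerivAt {v f g : ℝ → ℝ} {K : NNReal} (hv : LipschitzWith K v)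
    (hf : ∀ t, HasDerivAt f (v (f t)) t) (hg : ∀ t, HasDerivAt g (v (g t)) t) (s t : ℝ) :
    dist (f t) (g t) ≤ dist (f s) (g s) * Real.exp (K * |t - s|) := by
  rcases le_total s t with h | h
  · rw [abs_of_nonneg (sub_nonneg.2 h)]
    exact dist_le_of_hasDerivAt_of_le hv hf hg h
  · have reverse {f : ℝ → ℝ} (hf : ∀ t, HasDerivAt f (v (f t)) t) (t : ℝ) :
        HasDerivAt (fun t => f (-t)) (-v (f (-t))) t := by
      simpa [Function.comp_def] using (hf (-t)).comp t (hasDerivAt_neg t)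
    have key := dist_le_of_hasDerivAt_of_le hv.neg (reverse hf) (reverse hg) (neg_le_neg h)
    rw [abs_of_nonpos (sub_nonpos.2 h)]
    simpa [sub_eq_add_neg, add_comm] using key

/-- There exists a constant `K` (depending only on `σ`, `b`, `T`, the
path `m` and `x₀`, but not on `t` or `ε`) such that `|Y^ε t| ≤ K` and
`|X^ε t| = |F (m t, Y^ε t)| ≤ K` for all `t ∈ [0, T]` and all `ε > 0`, where `Y^ε` is the
continuous solution of the transformed integral equation. -/
theorem averaging_solution_uniform_bound
    (σ : ℝ → ℝ) (hσ : ContDiff ℝ 2 σ)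
    (C₁ : ℝ) (hC₁ : ∀ x, |deriv σ x| ≤ C₁)
    (C₂ : ℝ) (hC₂ : ∀ x, |deriv (deriv σ) x| ≤ C₂)
    (F H : ℝ × ℝ → ℝ)
    (hF0 : ∀ x : ℝ, F (0, x) = x)
    (hFr : ∀ r x : ℝ, HasDerivAt (fun r' : ℝ => F (r', x)) (σ (F (r, x))) r)
    (hH : ∀ r : ℝ, Function.LeftInverse (fun y : ℝ => H (r, y)) (fun x : ℝ => F (r, x)) ∧
      Function.RightInverse (fun y : ℝ => H (r, y)) (fun x : ℝ => F (r, x)))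
    (b : ℝ × ℝ → ℝ) (hbc : Continuous b)
    (B : ℝ) (hB : ∀ p, |b p| ≤ B)
    (L : ℝ → ℝ)
    (hbL : ∀ c : ℝ, 0 < c → ∀ x y t : ℝ, |x| ≤ c → |y| ≤ c →
      |b (x, t) - b (y, t)| ≤ L c * |x - y|)
    (T : ℝ) (hT : 0 < T)
    (m : ℝ → ℝ) (hm : ContinuousOn m (Set.Icc 0 T)) (hm0 : m 0 = 0)
    (x₀ : ℝ)
    :
    ∃ K : ℝ, ∀ ε : ℝ, 0 < ε → ∀ Y : ℝ → ℝ, SolvesAveragingODE F H b m T x₀ ε Y →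
      ∀ t ∈ Set.Icc (0:ℝ) T, |Y t| ≤ K ∧ |F (m t, Y t)| ≤ K := by
  have hC₁0 : 0 ≤ C₁ := (abs_nonneg _).trans (hC₁ 0)
  have hB0 : 0 ≤ B := (abs_nonneg _).trans (hB 0)
  have hσL : LipschitzWith C₁.toNNReal σ :=
    lipschitzWith_of_nnnorm_deriv_le (hσ.differentiable (by norm_num)) fun x => by
      rw [← NNReal.coe_le_coe, coe_nnnorm, Real.norm_eq_abs, Real.coe_toNNReal _ hC₁0]
      exact hC₁ x
  obtain ⟨M, hM⟩ := isCompact_Icc.exists_bound_of_continuousOn hm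
  simp only [Real.norm_eq_abs] at hM
  set E := Real.exp (C₁ * M)
  have hE0 : 0 < E := Real.exp_pos _
  have hexp {r : ℝ} (hr : |r| ≤ M) : Real.exp (C₁.toNNReal * |r|) ≤ E := by
    rw [Real.coe_toNNReal _ hC₁0]
    exact Real.exp_le_exp.2 (mul_le_mul_of_nonneg_left hr hC₁0)
  have hF_lip {r : ℝ} (hr : |r| ≤ M) (x y : ℝ) : dist (F (r, x)) (F (r, y)) ≤ E * dist x y := by
    have h := dist_le_of_hasDerivAt hσL (fun r => hFr r x) (fun r => hFr r y) 0 r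
    rw [hF0, hF0, sub_zero, mul_comm] at h
    exact h.trans (mul_le_mul_of_nonneg_right (hexp hr) dist_nonneg)
  have hH_lip {r : ℝ} (hr : |r| ≤ M) : LipschitzWith E.toNNReal (fun y => H (r, y)) := by
    refine LipschitzWith.of_dist_le_mul fun x y => ?_
    have h := dist_le_of_hasDerivAt hσL (fun s => hFr s (H (r, x))) (fun s => hFr s (H (r, y))) r 0
    have hx : F (r, H (r, x)) = x := (hH r).2 x
    have hy : F (r, H (r, y)) = y := (hH r).2 y
    rw [hF0, hF0, hx, hy, zero_sub, abs_neg, mul_comm] at h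
    rw [Real.coe_toNNReal _ hE0.le]
    exact h.trans (mul_le_mul_of_nonneg_right (hexp hr) dist_nonneg)
  have hF_cont : Continuous fun r => F (r, 0) :=
    continuous_iff_continuousAt.2 fun r => (hFr r 0).continuousAt
  obtain ⟨N, hN⟩ := isCompact_Icc.exists_bound_of_continuousOn (hF_cont.comp_continuousOn hm)
  simp only [Function.comp_apply, Real.norm_eq_abs] at hN
  set K := |H (0, x₀)| + E * B * T
  refine ⟨max K (N + E * K), fun ε _ Y hY t ht => ?_⟩
  have hYK : |Y t| ≤ K := by
    rw [hY.2 t ht]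
    refine (abs_add_le _ _).trans (add_le_add le_rfl ?_)
    rw [← Real.norm_eq_abs]
    refine (norm_integral_le_of_norm_le_const (E := ℝ) (C := E * B) fun s hs => ?_).trans ?_
    · rw [Set.uIoc_of_le ht.1] at hs
      rw [norm_mul]
      refine mul_le_mul ?_ (hB _) (norm_nonneg _) hE0.le
      have h := norm_deriv_le_of_lipschitz (x₀ := F (m s, Y s))
        (hH_lip (hM s ⟨hs.1.le, hs.2.trans ht.2⟩))
      rwa [Real.coe_toNNReal _ hE0.le] at h
    · rw [sub_zero, abs_of_nonneg ht.1]
      exact mul_le_mul_of_nonneg_left ht.2 (by positivity)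
  refine ⟨hYK.trans (le_max_left _ _), le_trans ?_ (le_max_right _ _)⟩
  have h := hF_lip (hM t ht) (Y t) 0
  rw [Real.dist_eq, Real.dist_eq, sub_zero] at h
  have := abs_sub_abs_le_abs_sub (F (m t, Y t)) (F (m t, 0))
  have := hN t ht
  have := mul_le_mul_of_nonneg_left hYK hE0.le
  linarith
end

section
/- With N := sup_{s ∈ [0,T]} |m_s|, the solution Y^ε is Lipschitz in time uniformly in ε: |Y^ε_t − Y^ε_s| ≤ exp(C₁ N) · B · |t − s| for all s, t ∈ [0, T] and all ε > 0. -/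
open intervalIntegral

/-- Two global solutions of an autonomous scalar ODE with Lipschitz vector field separate at most
exponentially, in both time directions. -/
lemma dist_le_mul_exp_abs_of_hasDerivAt {v : ℝ → ℝ} {K : NNReal} (hv : LipschitzWith K v)
    {f g : ℝ → ℝ} (hf : ∀ t, HasDerivAt f (v (f t)) t) (hg : ∀ t, HasDerivAt g (v (g t)) t)
    (a t : ℝ) : dist (f t) (g t) ≤ dist (f a) (g a) * Real.exp (K * |t - a|) := by
  rcases le_total a t with hat | hta
  · rw [abs_of_nonneg (sub_nonneg.2 hat)]
    exact dist_le_of_trajectories_ODE (v := fun _ => v) (fun _ => hv)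
      (fun s _ => (hf s).continuousAt.continuousWithinAt) (fun s _ => (hf s).hasDerivWithinAt)
      (fun s _ => (hg s).continuousAt.continuousWithinAt) (fun s _ => (hg s).hasDerivWithinAt)
      le_rfl t ⟨hat, le_rfl⟩
  · have reversed {h : ℝ → ℝ} (hh : ∀ t, HasDerivAt h (v (h t)) t) (s : ℝ) :
        HasDerivAt (fun r => h (-r)) (-v (h (-s))) s := by
      simpa [Function.comp_def] using (hh (-s)).comp s (hasDerivAt_neg s)
    have key := dist_le_of_trajectories_ODE (v := fun _ x => -v x) (K := K) (fun _ => hv.neg)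
      (fun s _ => (reversed hf s).continuousAt.continuousWithinAt)
      (fun s _ => (reversed hf s).hasDerivWithinAt)
      (fun s _ => (reversed hg s).continuousAt.continuousWithinAt)
      (fun s _ => (reversed hg s).hasDerivWithinAt)
      le_rfl (-t) (Set.mem_Icc.2 ⟨neg_le_neg hta, le_rfl⟩)
    rw [abs_of_nonpos (sub_nonpos.2 hta)]
    simpa only [neg_neg, neg_sub, sub_neg_eq_add, neg_add_eq_sub] using key

/-- The inverse flow map at time `r` is Lipschitz with constant `exp (K |r|)`. -/
lemma dist_inverse_flow_le {v : ℝ → ℝ} {K : NNReal} (hv : LipschitzWith K v)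
    {F H : ℝ × ℝ → ℝ} (hF0 : ∀ x, F (0, x) = x)
    (hFr : ∀ r x, HasDerivAt (fun r' => F (r', x)) (v (F (r, x))) r)
    (hFH : ∀ r y, F (r, H (r, y)) = y) (r y z : ℝ) :
    dist (H (r, y)) (H (r, z)) ≤ Real.exp (K * |r|) * dist y z := by
  have key := dist_le_mul_exp_abs_of_hasDerivAt hv (fun t => hFr t (H (r, y)))
    (fun t => hFr t (H (r, z))) r 0
  simpa [hF0, hFH, mul_comm] using key

/-- The inverse flow is jointly continuous in time and space. -/
lemma continuous_inverse_flow {v : ℝ → ℝ} {K : NNReal} (hv : LipschitzWith K v)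
    {F H : ℝ × ℝ → ℝ} (hF0 : ∀ x, F (0, x) = x)
    (hFr : ∀ r x, HasDerivAt (fun r' => F (r', x)) (v (F (r, x))) r)
    (hFH : ∀ r y, F (r, H (r, y)) = y) (hHF : ∀ r x, H (r, F (r, x)) = x) :
    Continuous H := by
  refine continuous_iff_continuousAt.2 fun ⟨r₀, y₀⟩ => ?_
  set x₀ := H (r₀, y₀) with hx₀
  have hFc : Continuous fun r => F (r, x₀) :=
    continuous_iff_continuousAt.2 fun r => (hFr r x₀).continuousAt
  have hbound : Continuous fun p : ℝ × ℝ => Real.exp (K * |p.1|) * dist p.2 (F (p.1, x₀)) := by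
    exact (by fun_prop : Continuous fun p : ℝ × ℝ => Real.exp (K * |p.1|)).mul
      (continuous_snd.dist (hFc.comp continuous_fst))
  refine tendsto_iff_dist_tendsto_zero.2 (squeeze_zero (fun _ => dist_nonneg) (fun p => ?_)
    (by simpa [hx₀, hFH] using hbound.tendsto (r₀, y₀)))
  simpa [hHF] using dist_inverse_flow_le hv hF0 hFr hFH p.1 p.2 (F (p.1, x₀))

/-- A flow of a Lipschitz vector field is jointly continuous in time and space. -/
lemma continuous_flow {v : ℝ → ℝ} {K : NNReal} (hv : LipschitzWith K v)
    {F : ℝ × ℝ → ℝ} (hF0 : ∀ x, F (0, x) = x)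
    (hFr : ∀ r x, HasDerivAt (fun r' => F (r', x)) (v (F (r, x))) r) : Continuous F := by
  refine continuous_iff_continuousAt.2 fun ⟨r₀, x₀⟩ => ?_
  have hFc : Continuous fun r => F (r, x₀) :=
    continuous_iff_continuousAt.2 fun r => (hFr r x₀).continuousAt
  have hbound : Continuous fun p : ℝ × ℝ =>
      dist p.2 x₀ * Real.exp (K * |p.1|) + dist (F (p.1, x₀)) (F (r₀, x₀)) := by
    exact (by fun_prop : Continuous fun p : ℝ × ℝ => dist p.2 x₀ * Real.exp (K * |p.1|)).add
      ((hFc.comp continuous_fst).dist continuous_const)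
  refine tendsto_iff_dist_tendsto_zero.2 (squeeze_zero (fun _ => dist_nonneg) (fun p => ?_)
    (by simpa using hbound.tendsto (r₀, x₀)))
  refine (dist_triangle _ (F (p.1, x₀)) _).trans (add_le_add_left ?_ _)
  simpa [hF0] using dist_le_mul_exp_abs_of_hasDerivAt hv (fun t => hFr t p.2)
    (fun t => hFr t x₀) 0 p.1

/-- With `N := sup_{s ∈ [0,T]} |m s|`, the solution `Y^ε` of the
transformed integral equation is Lipschitz in time uniformly in `ε`:
`|Y^ε t − Y^ε s| ≤ exp (C₁ N) · B · |t − s|` for all `s, t ∈ [0, T]` and all `ε > 0`. -/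
theorem averaging_solution_uniform_lipschitz
    (σ : ℝ → ℝ) (hσ : ContDiff ℝ 2 σ)
    (C₁ : ℝ) (hC₁ : ∀ x, |deriv σ x| ≤ C₁)
    (C₂ : ℝ) (hC₂ : ∀ x, |deriv (deriv σ) x| ≤ C₂)
    (F H : ℝ × ℝ → ℝ)
    (hF0 : ∀ x : ℝ, F (0, x) = x)
    (hFr : ∀ r x : ℝ, HasDerivAt (fun r' : ℝ => F (r', x)) (σ (F (r, x))) r)
    (hH : ∀ r : ℝ, Function.LeftInverse (fun y : ℝ => H (r, y)) (fun x : ℝ => F (r, x)) ∧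
      Function.RightInverse (fun y : ℝ => H (r, y)) (fun x : ℝ => F (r, x)))
    (b : ℝ × ℝ → ℝ) (hbc : Continuous b)
    (B : ℝ) (hB : ∀ p, |b p| ≤ B)
    (L : ℝ → ℝ)
    (hbL : ∀ c : ℝ, 0 < c → ∀ x y t : ℝ, |x| ≤ c → |y| ≤ c →
      |b (x, t) - b (y, t)| ≤ L c * |x - y|)
    (T : ℝ) (hT : 0 < T)
    (m : ℝ → ℝ) (hm : ContinuousOn m (Set.Icc 0 T)) (hm0 : m 0 = 0)
    (x₀ : ℝ)
    (N : ℝ) (hN : ∀ s ∈ Set.Icc (0:ℝ) T, |m s| ≤ N) :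
    ∀ ε : ℝ, 0 < ε → ∀ Y : ℝ → ℝ, SolvesAveragingODE F H b m T x₀ ε Y →
      ∀ s ∈ Set.Icc (0:ℝ) T, ∀ t ∈ Set.Icc (0:ℝ) T,
        |Y t - Y s| ≤ Real.exp (C₁ * N) * B * |t - s| := by
  intro ε _ Y ⟨hYc, hY⟩ s hs t ht
  have hC₁0 : 0 ≤ C₁ := (abs_nonneg _).trans (hC₁ 0)
  lift C₁ to NNReal using hC₁0
  have hLip : LipschitzWith C₁ σ :=
    lipschitzWith_of_nnnorm_deriv_le (hσ.differentiable (by norm_num)) fun x => hC₁ x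
  have hHF (r x : ℝ) : H (r, F (r, x)) = x := (hH r).1 x
  have hFH (r y : ℝ) : F (r, H (r, y)) = y := (hH r).2 y
  have hHc : Continuous H := continuous_inverse_flow hLip hF0 hFr hFH hHF
  have hFc : Continuous F := continuous_flow hLip hF0 hFr
  have hderiv (r y : ℝ) : |deriv (fun y : ℝ => H (r, y)) y| ≤ Real.exp (C₁ * |r|) := by
    have hlip : LipschitzWith ⟨Real.exp (C₁ * |r|), (Real.exp_pos _).le⟩ fun y => H (r, y) :=
      LipschitzWith.of_dist_le_mul (dist_inverse_flow_le hLip hF0 hFr hFH r)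
    exact norm_deriv_le_of_lipschitz hlip
  set g : ℝ → ℝ := fun s =>
    deriv (fun y : ℝ => H (m s, y)) (F (m s, Y s)) * b (F (m s, Y s), s / ε) with hg
  have hgle : ∀ u ∈ Set.Icc (0 : ℝ) T, ‖g u‖ ≤ Real.exp (C₁ * N) * B := fun u hu => by
    rw [hg, norm_mul]
    refine mul_le_mul ((hderiv _ _).trans (Real.exp_le_exp.2 ?_)) (hB _) (norm_nonneg _)
      (Real.exp_pos _).le
    exact mul_le_mul_of_nonneg_left (hN u hu) C₁.coe_nonneg
  have hgm : MeasureTheory.AEStronglyMeasurable g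
      (MeasureTheory.volume.restrict (Set.Icc 0 T)) := by
    have hFm : ContinuousOn (fun u => F (m u, Y u)) (Set.Icc 0 T) :=
      hFc.comp_continuousOn (hm.prodMk hYc)
    have hpair := (hm.prodMk hFm).aemeasurable (μ := MeasureTheory.volume) measurableSet_Icc
    have hD : Measurable fun p : ℝ × ℝ => deriv (fun y => H (p.1, y)) p.2 :=
      measurable_deriv_with_param (f := fun r y => H (r, y)) hHc
    refine ((hD.comp_aemeasurable hpair).mul ?_).aestronglyMeasurable
    exact (hbc.comp_continuousOn (hFm.prodMk (by fun_prop))).aemeasurable measurableSet_Icc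
  have hgi : MeasureTheory.IntegrableOn g (Set.Icc 0 T) :=
    MeasureTheory.IntegrableOn.of_bound (by simp) hgm _
      ((MeasureTheory.ae_restrict_iff' measurableSet_Icc).2 (.of_forall hgle))
  have hgii {u w : ℝ} (hu : u ∈ Set.Icc (0 : ℝ) T) (hw : w ∈ Set.Icc (0 : ℝ) T) :
      IntervalIntegrable g MeasureTheory.volume u w :=
    (hgi.mono_set (Set.ordConnected_Icc.uIcc_subset hu hw)).intervalIntegrable
  have h0 : (0 : ℝ) ∈ Set.Icc 0 T := ⟨le_rfl, hT.le⟩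
  rw [hY t ht, hY s hs, add_sub_add_left_eq_sub,
    integral_interval_sub_left (hgii h0 ht) (hgii h0 hs)]
  exact norm_integral_le_of_norm_le_const fun u hu =>
    hgle u (Set.ordConnected_Icc.uIcc_subset hs ht (Set.uIoc_subset_uIcc hu))
end

section
/- There exists a constant K (depending only on σ, b, T, the path m and x₀, but not on ε) such that |X^ε_t − X^ε_s| ≤ K( |m_t − m_s| + |t − s| ) for all s, t ∈ [0, T] and all ε > 0. -/
open intervalIntegral

open MeasureTheory Filter Topology

/-- Two trajectories of an autonomous ODE with Lipschitz right-hand side separate at most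
exponentially in forward time. -/
theorem abs_sub_le_exp_of_le {σ : ℝ → ℝ} {C : NNReal} (hσ : LipschitzWith C σ) {f g : ℝ → ℝ}
    (hf : ∀ r, HasDerivAt f (σ (f r)) r) (hg : ∀ r, HasDerivAt g (σ (g r)) r) {s r : ℝ}
    (hsr : s ≤ r) : |f r - g r| ≤ |f s - g s| * Real.exp (C * |r - s|) := by
  rw [abs_of_nonneg (sub_nonneg.2 hsr)]
  exact dist_le_of_trajectories_ODE (v := fun _ => σ) (K := C) (fun _ => hσ)
    (fun t _ => (hf t).continuousAt.continuousWithinAt) (fun t _ => (hf t).hasDerivWithinAt)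
    (fun t _ => (hg t).continuousAt.continuousWithinAt) (fun t _ => (hg t).hasDerivWithinAt)
    le_rfl r ⟨hsr, le_rfl⟩

/-- Two trajectories of an autonomous ODE with Lipschitz right-hand side separate at most
exponentially, in forward and backward time. -/
theorem abs_sub_le_exp {σ : ℝ → ℝ} {C : NNReal} (hσ : LipschitzWith C σ) {f g : ℝ → ℝ}
    (hf : ∀ r, HasDerivAt f (σ (f r)) r) (hg : ∀ r, HasDerivAt g (σ (g r)) r) (s r : ℝ) :
    |f r - g r| ≤ |f s - g s| * Real.exp (C * |r - s|) := by
  rcases le_total s r with h | h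
  · exact abs_sub_le_exp_of_le hσ hf hg h
  · have reverse {u : ℝ → ℝ} (hu : ∀ r, HasDerivAt u (σ (u r)) r) (r : ℝ) :
        HasDerivAt (fun r => u (-r)) (-σ (u (-r))) r := by
      simpa [Function.comp_def] using (hu (-r)).scomp r (hasDerivAt_neg r)
    have h' := abs_sub_le_exp_of_le hσ.neg (reverse hf) (reverse hg) (neg_le_neg h)
    rwa [neg_neg, neg_neg, show -r - -s = -(r - s) by ring, abs_neg] at h'

/-- A function of two variables that is continuous in the first one, and Lipschitz in the second
one locally uniformly in the first one, is jointly continuous. -/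
theorem continuous_of_abs_sub_le_mul {G : ℝ × ℝ → ℝ} {κ : ℝ → ℝ} (hκ : Continuous κ)
    (hG₁ : ∀ x, Continuous fun r => G (r, x))
    (hG₂ : ∀ r x y, |G (r, x) - G (r, y)| ≤ κ r * |x - y|) : Continuous G := by
  refine continuous_iff_continuousAt.2 fun ⟨r, x⟩ => ?_
  have h₁ : Tendsto (fun p : ℝ × ℝ => κ p.1 * |p.2 - x| + |G (p.1, x) - G (r, x)|)
      (𝓝 (r, x)) (𝓝 0) := by
    have hc : Continuous fun p : ℝ × ℝ => κ p.1 * |p.2 - x| + |G (p.1, x) - G (r, x)| := by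
      have := (hG₁ x).comp (continuous_fst (X := ℝ) (Y := ℝ))
      rw [Function.comp_def] at this
      exact ((hκ.comp continuous_fst).mul (by fun_prop)).add (this.sub continuous_const).abs
    simpa using hc.tendsto (r, x)
  refine tendsto_iff_dist_tendsto_zero.2 (squeeze_zero (fun _ => dist_nonneg) (fun p => ?_) h₁)
  calc |G p - G (r, x)| ≤ |G (p.1, p.2) - G (p.1, x)| + |G (p.1, x) - G (r, x)| :=
        abs_sub_le _ _ _
    _ ≤ _ := by gcongr; exact hG₂ _ _ _

/-- There exists a constant `K` (depending only on `σ`, `b`, `T`, the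
path `m` and `x₀`, but not on `ε`) such that for `X^ε t := F (m t, Y^ε t)` one has
`|X^ε t − X^ε s| ≤ K (|m t − m s| + |t − s|)` for all `s, t ∈ [0, T]` and all `ε > 0`. -/
theorem averaging_X_increment_bound
    (σ : ℝ → ℝ) (hσ : ContDiff ℝ 2 σ)
    (C₁ : ℝ) (hC₁ : ∀ x, |deriv σ x| ≤ C₁)
    (C₂ : ℝ) (hC₂ : ∀ x, |deriv (deriv σ) x| ≤ C₂)
    (F H : ℝ × ℝ → ℝ)
    (hF0 : ∀ x : ℝ, F (0, x) = x)
    (hFr : ∀ r x : ℝ, HasDerivAt (fun r' : ℝ => F (r', x)) (σ (F (r, x))) r)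
    (hH : ∀ r : ℝ, Function.LeftInverse (fun y : ℝ => H (r, y)) (fun x : ℝ => F (r, x)) ∧
      Function.RightInverse (fun y : ℝ => H (r, y)) (fun x : ℝ => F (r, x)))
    (b : ℝ × ℝ → ℝ) (hbc : Continuous b)
    (B : ℝ) (hB : ∀ p, |b p| ≤ B)
    (L : ℝ → ℝ)
    (hbL : ∀ c : ℝ, 0 < c → ∀ x y t : ℝ, |x| ≤ c → |y| ≤ c →
      |b (x, t) - b (y, t)| ≤ L c * |x - y|)
    (T : ℝ) (hT : 0 < T)
    (m : ℝ → ℝ) (hm : ContinuousOn m (Set.Icc 0 T)) (hm0 : m 0 = 0)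
    (x₀ : ℝ)
    :
    ∃ K : ℝ, ∀ ε : ℝ, 0 < ε → ∀ Y : ℝ → ℝ, SolvesAveragingODE F H b m T x₀ ε Y →
      ∀ s ∈ Set.Icc (0:ℝ) T, ∀ t ∈ Set.Icc (0:ℝ) T,
        |F (m t, Y t) - F (m s, Y s)| ≤ K * (|m t - m s| + |t - s|) := by
  have hC₁0 : 0 ≤ C₁ := (abs_nonneg _).trans (hC₁ 0)
  have hB0 : 0 ≤ B := (abs_nonneg _).trans (hB 0)
  lift C₁ to NNReal using hC₁0
  have hlip : LipschitzWith C₁ σ :=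
    lipschitzWith_of_nnnorm_deriv_le (hσ.differentiable (by norm_num)) fun x => hC₁ x
  have hFlip (r x y : ℝ) : |F (r, x) - F (r, y)| ≤ Real.exp (C₁ * |r|) * |x - y| := by
    have h := abs_sub_le_exp hlip (fun r => hFr r x) (fun r => hFr r y) 0 r
    rw [hF0, hF0, sub_zero] at h
    linarith
  have hFH (r y : ℝ) : F (r, H (r, y)) = y := (hH r).2 y
  have hH_le (r x y : ℝ) : |x - H (r, y)| ≤ Real.exp (C₁ * |r|) * |F (r, x) - y| := by
    have h := abs_sub_le_exp hlip (fun r' => hFr r' x) (fun r' => hFr r' (H (r, y))) r 0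
    rw [hF0, hF0, zero_sub, abs_neg, hFH] at h
    linarith
  have hHlip (r x y : ℝ) : |H (r, x) - H (r, y)| ≤ Real.exp (C₁ * |r|) * |x - y| := by
    simpa only [hFH] using hH_le r (H (r, x)) y
  have hκ : Continuous fun r : ℝ => Real.exp (C₁ * |r|) := by fun_prop
  have hFr_cont (x : ℝ) : Continuous fun r => F (r, x) :=
    continuous_iff_continuousAt.2 fun r => (hFr r x).continuousAt
  have hFcont : Continuous F := continuous_of_abs_sub_le_mul hκ hFr_cont hFlip
  have hHcont : Continuous H := by
    refine continuous_of_abs_sub_le_mul hκ (fun y => ?_) hHlip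
    refine continuous_iff_continuousAt.2 fun r => ?_
    have hc : Continuous fun r' => Real.exp (C₁ * |r'|) * |F (r', H (r, y)) - y| := by
      have := hFr_cont (H (r, y))
      fun_prop
    have h₀ := hc.tendsto r
    rw [hFH, sub_self, abs_zero, mul_zero] at h₀
    refine tendsto_iff_dist_tendsto_zero.2 (squeeze_zero (fun _ => dist_nonneg) (fun r' => ?_) h₀)
    rw [dist_comm]
    exact hH_le r' (H (r, y)) y
  have hHderiv (r y : ℝ) : |deriv (fun y : ℝ => H (r, y)) y| ≤ Real.exp (C₁ * |r|) := by
    have h : LipschitzWith ⟨Real.exp (C₁ * |r|), (Real.exp_pos _).le⟩ fun y : ℝ => H (r, y) :=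
      LipschitzWith.of_dist_le_mul fun x y => hHlip r x y
    exact norm_deriv_le_of_lipschitz h
  have hHmeas : Measurable fun p : ℝ × ℝ => deriv (fun y : ℝ => H (p.1, y)) p.2 :=
    measurable_deriv_with_param (f := fun r y => H (r, y)) hHcont
  obtain ⟨M, hM⟩ : ∃ M, ∀ t ∈ Set.Icc (0 : ℝ) T, |m t| ≤ M :=
    isCompact_Icc.exists_bound_of_continuousOn hm
  set E := Real.exp (C₁ * M) with hE
  have hE0 : 0 ≤ E := (Real.exp_pos _).le
  have hEm (t : ℝ) (ht : t ∈ Set.Icc (0 : ℝ) T) : Real.exp (C₁ * |m t|) ≤ E := by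
    rw [hE]; gcongr; exact hM t ht
  set D := E * B with hD
  have hD0 : 0 ≤ D := mul_nonneg hE0 hB0
  set R := |H (0, x₀)| + D * T with hR
  obtain ⟨S, hS⟩ : ∃ S, ∀ p ∈ Set.Icc (-M) M ×ˢ Set.Icc (-R) R, |σ (F p)| ≤ S :=
    (isCompact_Icc.prod isCompact_Icc).exists_bound_of_continuousOn
      (hσ.continuous.comp hFcont).continuousOn
  refine ⟨|S| + E * D, fun ε _ Y hY s hs t ht => ?_⟩
  obtain ⟨hYc, hYeq⟩ := hY
  set φ : ℝ → ℝ := fun s =>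
    deriv (fun y : ℝ => H (m s, y)) (F (m s, Y s)) * b (F (m s, Y s), s / ε) with hφ
  have hφ_le (u : ℝ) (hu : u ∈ Set.Icc (0 : ℝ) T) : ‖φ u‖ ≤ D := by
    rw [Real.norm_eq_abs, hφ, abs_mul]
    exact mul_le_mul ((hHderiv _ _).trans (hEm u hu)) (hB _) (abs_nonneg _) hE0
  have hφ_int : IntegrableOn φ (Set.Icc 0 T) := by
    have hX : ContinuousOn (fun s => F (m s, Y s)) (Set.Icc 0 T) :=
      hFcont.comp_continuousOn (hm.prodMk hYc)
    refine IntegrableOn.of_bound (by simp) ?_ D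
      ((ae_restrict_iff' measurableSet_Icc).2 (.of_forall hφ_le))
    refine AEMeasurable.aestronglyMeasurable (.mul ?_ ?_)
    · exact hHmeas.comp_aemeasurable ((hm.prodMk hX).aemeasurable measurableSet_Icc)
    · exact (hbc.comp_continuousOn
        (hX.prodMk (continuous_id.div_const ε).continuousOn)).aemeasurable measurableSet_Icc
  have h0 : (0 : ℝ) ∈ Set.Icc (0 : ℝ) T := ⟨le_rfl, hT.le⟩
  have hint {u v : ℝ} (hu : u ∈ Set.Icc (0 : ℝ) T) (hv : v ∈ Set.Icc (0 : ℝ) T) :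
      IntervalIntegrable φ volume u v :=
    (hφ_int.mono_set (Set.uIcc_subset_Icc hu hv)).intervalIntegrable
  have hYlip {u v : ℝ} (hu : u ∈ Set.Icc (0 : ℝ) T) (hv : v ∈ Set.Icc (0 : ℝ) T) :
      |Y v - Y u| ≤ D * |v - u| := by
    rw [hYeq v hv, hYeq u hu, add_sub_add_left_eq_sub,
      integral_interval_sub_left (hint h0 hv) (hint h0 hu)]
    exact intervalIntegral.norm_integral_le_of_norm_le_const fun w hw =>
      hφ_le w (Set.uIcc_subset_Icc hu hv (Set.uIoc_subset_uIcc hw))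
  have hYs : Y s ∈ Set.Icc (-R) R := by
    have hY0 : Y 0 = H (0, x₀) := by simpa using hYeq 0 h0
    have h := hYlip h0 hs
    rw [sub_zero, abs_of_nonneg hs.1] at h
    refine abs_le.1 ?_
    calc |Y s| ≤ |Y 0| + |Y s - Y 0| := by linarith [abs_sub_abs_le_abs_sub (Y s) (Y 0)]
      _ ≤ |H (0, x₀)| + D * T := by
        rw [hY0] at h ⊢
        gcongr
        exact h.trans (by gcongr; exact hs.2)
  have hFm : |F (m t, Y s) - F (m s, Y s)| ≤ S * |m t - m s| :=
    (convex_Icc (-M) M).norm_image_sub_le_of_norm_hasDerivWithin_le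
      (fun r _ => (hFr r (Y s)).hasDerivWithinAt) (fun r hr => hS (r, Y s) ⟨hr, hYs⟩)
      (abs_le.1 (hM s hs)) (abs_le.1 (hM t ht))
  calc |F (m t, Y t) - F (m s, Y s)|
      ≤ |F (m t, Y t) - F (m t, Y s)| + |F (m t, Y s) - F (m s, Y s)| := abs_sub_le _ _ _
    _ ≤ E * (D * |t - s|) + |S| * |m t - m s| := by
        refine add_le_add ((hFlip _ _ _).trans ?_) (hFm.trans ?_)
        · exact mul_le_mul (hEm t ht) (hYlip hs ht) (abs_nonneg _) hE0
        · gcongr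
          exact le_abs_self S
    _ ≤ (|S| + E * D) * (|m t - m s| + |t - s|) := by
        have h₁ : 0 ≤ |S| * |t - s| := by positivity
        have h₂ : 0 ≤ E * D * |m t - m s| := by positivity
        linarith
end

section
/- There exists a constant K (depending only on σ, b, T, the path m and x₀) such that for every ε ∈ (0, 1] and every integer n ≥ 1, setting Δ := T/n, one has sup_{t ∈ [0, T]} |X^ε_t − X̄_t| ≤ K ( nε + 1/n + ∫₀^T |m_s − m_{⌊s/Δ⌋Δ}| ds ). -/
open intervalIntegral

/-- The difference of two distinct orbits of a one-dimensional flow is the initial difference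
times the exponential of the integral of the divided differences of the vector field. -/
lemma flow_sub_eq_mul_exp_integral {σ : ℝ → ℝ} (hσ : Continuous σ) {u v : ℝ → ℝ}
    (hu : ∀ r, HasDerivAt u (σ (u r)) r) (hv : ∀ r, HasDerivAt v (σ (v r)) r)
    (hne : ∀ r, u r ≠ v r) (r : ℝ) :
    u r - v r = (u 0 - v 0) * Real.exp (∫ s in (0:ℝ)..r, (σ (u s) - σ (v s)) / (u s - v s)) := by
  have hucont : Continuous u := continuous_iff_continuousAt.2 fun s => (hu s).continuousAt
  have hvcont : Continuous v := continuous_iff_continuousAt.2 fun s => (hv s).continuousAt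
  set q : ℝ → ℝ := fun s => (σ (u s) - σ (v s)) / (u s - v s) with hq
  have hqcont : Continuous q :=
    ((hσ.comp hucont).sub (hσ.comp hvcont)).div (hucont.sub hvcont) fun s => sub_ne_zero.2 (hne s)
  have hI : ∀ s, HasDerivAt (fun s => ∫ w in (0:ℝ)..s, q w) (q s) s := fun s =>
    hqcont.integral_hasStrictDerivAt 0 s |>.hasDerivAt
  have hD : ∀ s, HasDerivAt (fun s => (u s - v s) * Real.exp (-∫ w in (0:ℝ)..s, q w)) 0 s := by
    intro s
    refine (((hu s).sub (hv s)).mul (hI s).neg.exp).congr_deriv ?_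
    have h := sub_ne_zero.2 (hne s)
    have hqs : q s * (u s - v s) = σ (u s) - σ (v s) := by
      simp only [hq]; field_simp
    simp only [Pi.sub_apply]
    rw [← hqs]; ring
  have h := is_const_of_deriv_eq_zero (fun s => (hD s).differentiableAt) (fun s => (hD s).deriv) r 0
  simp only [integral_same, neg_zero, Real.exp_zero, mul_one] at h
  rw [← h, mul_assoc, ← Real.exp_add]
  simp

/-- A divided difference of `σ` is a value of `deriv σ` at a point close to the first argument. -/
lemma exists_deriv_eq_div_sub {σ : ℝ → ℝ} (hσ : Differentiable ℝ σ) {x y : ℝ} (hxy : x ≠ y) :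
    ∃ ξ, |ξ - x| ≤ |y - x| ∧ (σ y - σ x) / (y - x) = deriv σ ξ := by
  rcases lt_or_gt_of_ne hxy with h | h
  · obtain ⟨ξ, hξ, h'⟩ := exists_deriv_eq_slope σ h hσ.continuous.continuousOn hσ.differentiableOn
    refine ⟨ξ, ?_, h'.symm⟩
    rw [abs_of_pos (sub_pos.2 hξ.1), abs_of_pos (sub_pos.2 h)]
    linarith [hξ.2]
  · obtain ⟨ξ, hξ, h'⟩ := exists_deriv_eq_slope σ h hσ.continuous.continuousOn hσ.differentiableOn
    refine ⟨ξ, ?_, ?_⟩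
    · rw [abs_of_neg (sub_neg.2 hξ.2), abs_of_neg (sub_neg.2 h)]
      linarith [hξ.1]
    · rw [h', ← neg_sub (σ x), ← neg_sub x, neg_div_neg_eq]

/-- A bound on the derivative is a Lipschitz constant. -/
lemma abs_sub_le_of_abs_deriv_le {f : ℝ → ℝ} (hf : Differentiable ℝ f) {C : ℝ}
    (hC : ∀ x, |deriv f x| ≤ C) (x y : ℝ) : |f x - f y| ≤ C * |x - y| :=
  Convex.norm_image_sub_le_of_norm_deriv_le (s := Set.univ) (fun z _ => hf z) (fun z _ => hC z)
    convex_univ trivial trivial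

section Flow

variable {σ : ℝ → ℝ} {C₁ C₂ : ℝ} {F H : ℝ × ℝ → ℝ}

lemma flow_continuous (hFr : ∀ r x : ℝ, HasDerivAt (fun r' : ℝ => F (r', x)) (σ (F (r, x))) r)
    (x : ℝ) : Continuous fun r => F (r, x) :=
  continuous_iff_continuousAt.2 fun r => (hFr r x).continuousAt

lemma flow_sub_eq (hσ : Continuous σ) (hF0 : ∀ x : ℝ, F (0, x) = x)
    (hFr : ∀ r x : ℝ, HasDerivAt (fun r' : ℝ => F (r', x)) (σ (F (r, x))) r)
    (hinj : ∀ r, Function.Injective fun x => F (r, x)) {x y : ℝ} (hxy : y ≠ x) (r : ℝ) :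
    F (r, y) - F (r, x) = (y - x) *
      Real.exp (∫ s in (0:ℝ)..r, (σ (F (s, y)) - σ (F (s, x))) / (F (s, y) - F (s, x))) := by
  have h := flow_sub_eq_mul_exp_integral hσ (hFr · y) (hFr · x) (fun s => (hinj s).ne hxy) r
  rwa [hF0, hF0] at h

lemma abs_integral_divided_difference_le (hσ : Differentiable ℝ σ) (hC₁ : ∀ x, |deriv σ x| ≤ C₁)
    (hinj : ∀ r, Function.Injective fun x => F (r, x)) {x y : ℝ} (hxy : y ≠ x) (r : ℝ) :
    |∫ s in (0:ℝ)..r, (σ (F (s, y)) - σ (F (s, x))) / (F (s, y) - F (s, x))| ≤ C₁ * |r| := by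
  have h := norm_integral_le_of_norm_le_const (a := 0) (b := r) (C := C₁)
    (f := fun s => (σ (F (s, y)) - σ (F (s, x))) / (F (s, y) - F (s, x))) (by
      intro s _
      obtain ⟨ξ, -, h⟩ := exists_deriv_eq_div_sub hσ ((hinj s).ne hxy.symm)
      rw [h]
      exact hC₁ ξ)
  simpa using h

lemma abs_flow_sub_le (hσ : Differentiable ℝ σ) (hC₁ : ∀ x, |deriv σ x| ≤ C₁)
    (hF0 : ∀ x : ℝ, F (0, x) = x)
    (hFr : ∀ r x : ℝ, HasDerivAt (fun r' : ℝ => F (r', x)) (σ (F (r, x))) r)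
    (hinj : ∀ r, Function.Injective fun x => F (r, x)) (x y r : ℝ) :
    |F (r, y) - F (r, x)| ≤ Real.exp (C₁ * |r|) * |y - x| := by
  rcases eq_or_ne y x with rfl | hxy
  · simp
  · rw [flow_sub_eq hσ.continuous hF0 hFr hinj hxy, abs_mul, Real.abs_exp, mul_comm]
    gcongr
    exact (le_abs_self _).trans (abs_integral_divided_difference_le hσ hC₁ hinj hxy r)

lemma abs_sub_le_flow_sub (hσ : Differentiable ℝ σ) (hC₁ : ∀ x, |deriv σ x| ≤ C₁)
    (hF0 : ∀ x : ℝ, F (0, x) = x)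
    (hFr : ∀ r x : ℝ, HasDerivAt (fun r' : ℝ => F (r', x)) (σ (F (r, x))) r)
    (hinj : ∀ r, Function.Injective fun x => F (r, x)) (x y r : ℝ) :
    |y - x| ≤ Real.exp (C₁ * |r|) * |F (r, y) - F (r, x)| := by
  rcases eq_or_ne y x with rfl | hxy
  · simp
  · rw [flow_sub_eq hσ.continuous hF0 hFr hinj hxy, abs_mul, Real.abs_exp, mul_left_comm,
      ← Real.exp_add]
    refine le_mul_of_one_le_right (abs_nonneg _) (Real.one_le_exp ?_)
    linarith [neg_le_of_abs_le (abs_integral_divided_difference_le hσ hC₁ hinj hxy r)]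

/-- Differentiability of the flow in its initial condition. -/
lemma hasDerivAt_flow (hσ : ContDiff ℝ 2 σ) (hC₁ : ∀ x, |deriv σ x| ≤ C₁)
    (hC₂ : ∀ x, |deriv (deriv σ) x| ≤ C₂) (hF0 : ∀ x : ℝ, F (0, x) = x)
    (hFr : ∀ r x : ℝ, HasDerivAt (fun r' : ℝ => F (r', x)) (σ (F (r, x))) r)
    (hinj : ∀ r, Function.Injective fun x => F (r, x)) (r x : ℝ) :
    HasDerivAt (fun y => F (r, y)) (Real.exp (∫ s in (0:ℝ)..r, deriv σ (F (s, x)))) x := by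
  have hd : Differentiable ℝ σ := hσ.differentiable (by norm_num)
  have hσ' : ContDiff ℝ 1 (deriv σ) := (contDiff_succ_iff_deriv.1 hσ).2.2
  have hC₁0 : 0 ≤ C₁ := (abs_nonneg _).trans (hC₁ 0)
  have hC₂0 : 0 ≤ C₂ := (abs_nonneg _).trans (hC₂ 0)
  have hbound : ∀ y, y ≠ x →
      |(∫ s in (0:ℝ)..r, (σ (F (s, y)) - σ (F (s, x))) / (F (s, y) - F (s, x))) -
        ∫ s in (0:ℝ)..r, deriv σ (F (s, x))| ≤ C₂ * Real.exp (C₁ * |r|) * |r| * |y - x| := by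
    intro y hxy
    have hcx := flow_continuous hFr x
    have hcy := flow_continuous hFr y
    rw [← integral_sub]
    · have h := norm_integral_le_of_norm_le_const (a := 0) (b := r)
        (C := C₂ * (Real.exp (C₁ * |r|) * |y - x|))
        (f := fun s => (σ (F (s, y)) - σ (F (s, x))) / (F (s, y) - F (s, x)) -
          deriv σ (F (s, x))) (by
          intro s hs
          obtain ⟨ξ, hξ, h⟩ := exists_deriv_eq_div_sub hd ((hinj s).ne hxy.symm)
          rw [h, Real.norm_eq_abs]
          refine (abs_sub_le_of_abs_deriv_le (hσ'.differentiable one_ne_zero) hC₂ _ _).trans ?_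
          have hsr : |s| ≤ |r| := by
            simpa using Set.abs_sub_left_of_mem_uIcc (Set.uIoc_subset_uIcc hs)
          gcongr
          refine hξ.trans ((abs_flow_sub_le hd hC₁ hF0 hFr hinj x y s).trans ?_)
          gcongr)
      rw [Real.norm_eq_abs, sub_zero] at h
      exact h.trans_eq (by ring)
    · refine Continuous.intervalIntegrable ?_ _ _
      exact ((hd.continuous.comp hcy).sub (hd.continuous.comp hcx)).div (hcy.sub hcx)
        fun s => sub_ne_zero.2 ((hinj s).ne hxy)
    · exact (hσ'.continuous.comp hcx).intervalIntegrable _ _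
  rw [hasDerivAt_iff_tendsto_slope]
  have hlim : Filter.Tendsto (fun y => Real.exp
      (∫ s in (0:ℝ)..r, (σ (F (s, y)) - σ (F (s, x))) / (F (s, y) - F (s, x))))
      (nhdsWithin x {x}ᶜ) (nhds (Real.exp (∫ s in (0:ℝ)..r, deriv σ (F (s, x))))) := by
    refine (Real.continuous_exp.tendsto _).comp ?_
    rw [tendsto_iff_dist_tendsto_zero]
    refine squeeze_zero' (Filter.Eventually.of_forall fun _ => dist_nonneg)
      (g := fun y => C₂ * Real.exp (C₁ * |r|) * |r| * |y - x|) ?_ ?_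
    · filter_upwards [self_mem_nhdsWithin] with y hy
      exact hbound y hy
    · have : Continuous fun y => C₂ * Real.exp (C₁ * |r|) * |r| * |y - x| := by fun_prop
      have h := (this.tendsto x).mono_left (nhdsWithin_le_nhds (s := {x}ᶜ))
      simpa using h
  refine hlim.congr' ?_
  filter_upwards [self_mem_nhdsWithin] with y hy
  rw [slope_def_field, flow_sub_eq hd.continuous hF0 hFr hinj hy]
  rw [mul_div_cancel_left₀ _ (sub_ne_zero.2 hy)]

/-- The derivative of the inverse flow along the flow. -/
lemma deriv_inverse_flow (hσ : ContDiff ℝ 2 σ) (hC₁ : ∀ x, |deriv σ x| ≤ C₁)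
    (hC₂ : ∀ x, |deriv (deriv σ) x| ≤ C₂) (hF0 : ∀ x : ℝ, F (0, x) = x)
    (hFr : ∀ r x : ℝ, HasDerivAt (fun r' : ℝ => F (r', x)) (σ (F (r, x))) r)
    (hH : ∀ r : ℝ, Function.LeftInverse (fun y : ℝ => H (r, y)) (fun x : ℝ => F (r, x)) ∧
      Function.RightInverse (fun y : ℝ => H (r, y)) (fun x : ℝ => F (r, x))) (r x : ℝ) :
    deriv (fun y => H (r, y)) (F (r, x)) =
      Real.exp (-∫ s in (0:ℝ)..r, deriv σ (F (s, x))) := by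
  have hd : Differentiable ℝ σ := hσ.differentiable (by norm_num)
  have hinj : ∀ r, Function.Injective fun x => F (r, x) := fun r => (hH r).1.injective
  have hlip : LipschitzWith ⟨Real.exp (C₁ * |r|), (Real.exp_pos _).le⟩ fun y => H (r, y) := by
    refine LipschitzWith.of_dist_le_mul fun y z => ?_
    have h := abs_sub_le_flow_sub hd hC₁ hF0 hFr hinj (H (r, z)) (H (r, y)) r
    have hy : F (r, H (r, y)) = y := (hH r).2 y
    have hz : F (r, H (r, z)) = z := (hH r).2 z
    rwa [hy, hz] at h
  rw [Real.exp_neg]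
  refine (HasDerivAt.of_local_left_inverse hlip.continuous.continuousAt (f := fun y => F (r, y))
    ?_ (Real.exp_pos _).ne' (Filter.Eventually.of_forall (hH r).2)).deriv
  have h : H (r, F (r, x)) = x := (hH r).1 x
  simp only [h]
  exact hasDerivAt_flow hσ hC₁ hC₂ hF0 hFr hinj r x

end Flow

/-- Grönwall's inequality in integral form. -/
lemma le_mul_exp_of_le_add_mul_integral {φ : ℝ → ℝ} {T E C : ℝ} (hT : 0 ≤ T) (hC : 0 < C)
    (hφ : ContinuousOn φ (Set.Icc 0 T)) (hφ0 : ∀ t ∈ Set.Icc 0 T, 0 ≤ φ t)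
    (h : ∀ t ∈ Set.Icc 0 T, φ t ≤ E + C * ∫ s in (0:ℝ)..t, φ s) :
    ∀ t ∈ Set.Icc 0 T, φ t ≤ E * Real.exp (C * t) := by
  set χ : ℝ → ℝ := Set.IccExtend hT (Set.domRestrict (Set.Icc 0 T) φ) with hχ
  have hχc : Continuous χ := hφ.domRestrict.Icc_extend'
  have hχφ : ∀ t ∈ Set.Icc 0 T, χ t = φ t := fun t ht => Set.IccExtend_of_mem hT _ ht
  have hint : ∀ t ∈ Set.Icc 0 T, ∫ s in (0:ℝ)..t, φ s = ∫ s in (0:ℝ)..t, χ s := by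
    intro t ht
    refine integral_congr fun s hs => (hχφ s ?_).symm
    rw [Set.uIcc_of_le ht.1] at hs
    exact ⟨hs.1, hs.2.trans ht.2⟩
  have hψ0 : ∀ t ∈ Set.Icc 0 T, 0 ≤ ∫ s in (0:ℝ)..t, χ s := fun t ht =>
    integral_nonneg ht.1 fun s hs => by
      have hs' : s ∈ Set.Icc 0 T := ⟨hs.1, hs.2.trans ht.2⟩
      rw [hχφ s hs']
      exact hφ0 s hs'
  have hψ : ∀ t, HasDerivAt (fun t => ∫ s in (0:ℝ)..t, χ s) (χ t) t := fun t =>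
    (hχc.integral_hasStrictDerivAt 0 t).hasDerivAt
  have hg := norm_le_gronwallBound_of_norm_deriv_right_le (f := fun t => ∫ s in (0:ℝ)..t, χ s)
    (f' := χ) (δ := 0) (K := C) (ε := E) (a := 0) (b := T)
    (fun t _ => (hψ t).continuousAt.continuousWithinAt) (fun t _ => (hψ t).hasDerivWithinAt)
    (by simp) (fun t ht => by
      have ht' := Set.Ico_subset_Icc_self ht
      rw [Real.norm_of_nonneg (hψ0 t ht'), hχφ t ht', Real.norm_of_nonneg (hφ0 t ht'),
        ← hint t ht', add_comm]
      exact h t ht')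
  intro t ht
  have h1 := hg t ht
  rw [Real.norm_of_nonneg (hψ0 t ht), gronwallBound_of_K_ne_0 hC.ne', ← hint t ht] at h1
  simp only [zero_mul, zero_add, sub_zero] at h1
  refine (h t ht).trans ((add_le_add_right (mul_le_mul_of_nonneg_left h1 hC.le) E).trans_eq ?_)
  field_simp
  ring

lemma floor_div_eq_of_mem_Ico {Δ s : ℝ} (hΔ : 0 < Δ) {k : ℕ}
    (hs : s ∈ Set.Ico (k * Δ) ((k + 1) * Δ)) : ⌊s / Δ⌋ = k := by
  rw [Int.floor_eq_iff]
  exact ⟨(le_div_iff₀ hΔ).2 (by exact_mod_cast hs.1),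
    (div_lt_iff₀ hΔ).2 (by exact_mod_cast hs.2)⟩

/-- An integrand frozen on each mesh interval is integrable, and its integral is bounded by the
number of intervals times a uniform bound for the contribution of one interval. -/
lemma abs_integral_floor_le {f : ℝ → ℝ → ℝ} {Δ c : ℝ} (hΔ : 0 < Δ) (n : ℕ)
    (hf : ∀ k < n, Continuous (f (k * Δ)))
    (hc : ∀ k < n, ∀ t ∈ Set.Icc (k * Δ) ((k + 1) * Δ),
      |∫ s in (k * Δ)..t, f (k * Δ) s| ≤ c) :
    ∀ t ∈ Set.Icc 0 (n * Δ),
      IntervalIntegrable (fun s => f (⌊s / Δ⌋ * Δ) s) MeasureTheory.volume 0 t ∧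
      |∫ s in (0:ℝ)..t, f (⌊s / Δ⌋ * Δ) s| ≤ n * c := by
  induction n with
  | zero =>
    intro t ht
    obtain rfl : t = 0 := by simpa using ht
    simp
  | succ n ih =>
    have ih' := ih (fun k hk => hf k (hk.trans n.lt_succ_self))
      (fun k hk => hc k (hk.trans n.lt_succ_self))
    have hc0 : 0 ≤ c := (abs_nonneg _).trans (hc n n.lt_succ_self _
      (Set.left_mem_Icc.2 (by gcongr; linarith)))
    intro t ht
    rcases le_total t (n * Δ) with h | h
    · refine ⟨(ih' t ⟨ht.1, h⟩).1, (ih' t ⟨ht.1, h⟩).2.trans ?_⟩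
      gcongr
      simp
    · obtain ⟨h1, h2⟩ := ih' (n * Δ) ⟨by positivity, le_rfl⟩
      have ht2 : t ≤ (n + 1) * Δ := by simpa using ht.2
      have hEq : Set.EqOn (fun s => f (n * Δ) s) (fun s => f (⌊s / Δ⌋ * Δ) s)
          (Set.Ioo (n * Δ) t) := fun s hs => by
        have := floor_div_eq_of_mem_Ico hΔ (k := n) ⟨hs.1.le, hs.2.trans_le ht2⟩
        simp [this]
      have h3 : IntervalIntegrable (fun s => f (⌊s / Δ⌋ * Δ) s) MeasureTheory.volume (n * Δ) t :=
        ((hf n n.lt_succ_self).intervalIntegrable _ _).congr_uIoo (by rwa [Set.uIoo_of_le h])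
      refine ⟨h1.trans h3, ?_⟩
      rw [← integral_add_adjacent_intervals h1 h3, ← integral_congr_Ioo_of_le h hEq]
      refine (abs_add_le _ _).trans ((add_le_add h2 (hc n n.lt_succ_self t ⟨h, ht2⟩)).trans_eq ?_)
      push_cast
      ring

lemma floor_div_mul_mem_Icc {Δ s : ℝ} (hΔ : 0 < Δ) (hs : 0 ≤ s) :
    (⌊s / Δ⌋ : ℝ) * Δ ∈ Set.Icc (s - Δ) s ∧ 0 ≤ (⌊s / Δ⌋ : ℝ) * Δ := by
  have h1 : (⌊s / Δ⌋ : ℝ) * Δ ≤ s := (le_div_iff₀ hΔ).1 (Int.floor_le _)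
  have h2 : s < ((⌊s / Δ⌋ : ℝ) + 1) * Δ := (div_lt_iff₀ hΔ).1 (Int.lt_floor_add_one _)
  have h3 : (0 : ℝ) ≤ ⌊s / Δ⌋ := by exact_mod_cast Int.floor_nonneg.2 (by positivity)
  exact ⟨⟨by linarith, h1⟩, by positivity⟩

/-- The oscillation of a continuous path along a mesh is integrable. -/
lemma intervalIntegrable_abs_sub_floor {m : ℝ → ℝ} {T R Δ : ℝ} (hT : 0 ≤ T) (hΔ : 0 < Δ)
    (hm : ContinuousOn m (Set.Icc 0 T)) (hR : ∀ s ∈ Set.Icc 0 T, |m s| ≤ R) :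
    IntervalIntegrable (fun s => |m s - m (⌊s / Δ⌋ * Δ)|) MeasureTheory.volume 0 T := by
  refine (IntervalIntegrable.sub (hm.intervalIntegrable_of_Icc hT) ?_).abs
  rw [intervalIntegrable_iff_integrableOn_Icc_of_le hT]
  refine MeasureTheory.Measure.integrableOn_of_bounded (M := R) (by simp) ?_ ?_
  · have h1 : Measurable fun s : ℝ => ⌊s / Δ⌋ :=
      Int.measurable_floor.comp (measurable_id.div_const Δ)
    have h2 : Measurable fun k : ℤ => m (k * Δ) := measurable_from_top
    exact (h2.comp h1).aestronglyMeasurable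
  · refine (MeasureTheory.ae_restrict_iff' measurableSet_Icc).2 (Filter.Eventually.of_forall ?_)
    intro s hs
    have h := floor_div_mul_mem_Icc hΔ hs.1
    exact hR _ ⟨h.2, h.1.2.trans hs.2⟩

/-- A function Lipschitz in its first two variables and continuous in the third one is continuous
along continuous paths. -/
lemma continuousOn_of_lipschitz_of_continuous {g : ℝ → ℝ → ℝ → ℝ} {T R ρ Λ ε : ℝ}
    {m Y : ℝ → ℝ}
    (hg : ∀ r r' y y' τ, |r| ≤ R → |r'| ≤ R → |y| ≤ ρ → |y'| ≤ ρ →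
      |g r y τ - g r' y' τ| ≤ Λ * (|r - r'| + |y - y'|))
    (hgc : ∀ r y, Continuous (g r y))
    (hm : ContinuousOn m (Set.Icc 0 T)) (hR : ∀ s ∈ Set.Icc 0 T, |m s| ≤ R)
    (hY : ContinuousOn Y (Set.Icc 0 T)) (hρ : ∀ s ∈ Set.Icc 0 T, |Y s| ≤ ρ) :
    ContinuousOn (fun s => g (m s) (Y s) (s / ε)) (Set.Icc 0 T) := by
  intro t ht
  rw [ContinuousWithinAt, tendsto_iff_dist_tendsto_zero]
  refine squeeze_zero' (Filter.Eventually.of_forall fun _ => dist_nonneg)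
    (g := fun s => Λ * (|m s - m t| + |Y s - Y t|) +
      |g (m t) (Y t) (s / ε) - g (m t) (Y t) (t / ε)|) ?_ ?_
  · filter_upwards [self_mem_nhdsWithin] with s hs
    exact (abs_sub_le _ (g (m t) (Y t) (s / ε)) _).trans (add_le_add_left
      (hg _ _ _ _ _ (hR s hs) (hR t ht) (hρ s hs) (hρ t ht)) _)
  · have h : ContinuousWithinAt (fun s => Λ * (|m s - m t| + |Y s - Y t|) +
        |g (m t) (Y t) (s / ε) - g (m t) (Y t) (t / ε)|) (Set.Icc 0 T) t := by
      refine ContinuousWithinAt.add (continuousWithinAt_const.mul (ContinuousWithinAt.add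
        ((hm t ht).sub continuousWithinAt_const).abs
        ((hY t ht).sub continuousWithinAt_const).abs)) ?_
      have : Continuous fun s => |g (m t) (Y t) (s / ε) - g (m t) (Y t) (t / ε)| :=
        (((hgc _ _).comp (continuous_id.div_const ε)).sub continuous_const).abs
      exact this.continuousWithinAt
    have h0 := h.tendsto
    simpa using h0

/-- Averaging estimate for `Y' = g (m, Y, s / ε)` driven by a bounded continuous path `m`. -/
lemma averaging_estimate {g : ℝ → ℝ → ℝ → ℝ} {gbar : ℝ → ℝ → ℝ} {T R ρ Λ Γ N ε y₀ : ℝ}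
    {m Y Ybar : ℝ → ℝ} (hT : 0 < T) (hε : 0 < ε) (hΛ : 0 < Λ)
    (hg : ∀ r r' y y' τ, |r| ≤ R → |r'| ≤ R → |y| ≤ ρ → |y'| ≤ ρ →
      |g r y τ - g r' y' τ| ≤ Λ * (|r - r'| + |y - y'|))
    (hgbar : ∀ r r' y y', |r| ≤ R → |r'| ≤ R → |y| ≤ ρ → |y'| ≤ ρ →
      |gbar r y - gbar r' y'| ≤ Λ * (|r - r'| + |y - y'|))
    (hgc : ∀ r y, Continuous (g r y))
    (hΓ : ∀ r y τ, |r| ≤ R → |g r y τ| ≤ Γ)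
    (hN : ∀ r y u v, |r| ≤ R → 0 ≤ u → u ≤ v → |∫ s in u..v, (g r y s - gbar r y)| ≤ N)
    (hm : ContinuousOn m (Set.Icc 0 T)) (hR : ∀ s ∈ Set.Icc 0 T, |m s| ≤ R)
    (hY : ContinuousOn Y (Set.Icc 0 T)) (hρ : ∀ s ∈ Set.Icc 0 T, |Y s| ≤ ρ)
    (hYbar : ContinuousOn Ybar (Set.Icc 0 T)) (hρbar : ∀ s ∈ Set.Icc 0 T, |Ybar s| ≤ ρ)
    (hYeq : ∀ t ∈ Set.Icc 0 T, Y t = y₀ + ∫ s in (0:ℝ)..t, g (m s) (Y s) (s / ε))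
    (hYbareq : ∀ t ∈ Set.Icc 0 T, Ybar t = y₀ + ∫ s in (0:ℝ)..t, gbar (m s) (Ybar s))
    {n : ℕ} (hn : 1 ≤ n) {t : ℝ} (ht : t ∈ Set.Icc 0 T) :
    |Y t - Ybar t| ≤ (2 * Λ * ((∫ s in (0:ℝ)..T,
      |m s - m ((⌊s / (T / (n : ℝ))⌋ : ℝ) * (T / (n : ℝ)))|) + Γ * (T / n) * T) + n * (ε * N)) *
        Real.exp (Λ * T) := by
  have hn0 : (0 : ℝ) < n := by exact_mod_cast hn
  set Δ : ℝ := T / n with hΔdef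
  have hΔ : 0 < Δ := by positivity
  have hnΔ : n * Δ = T := by rw [hΔdef]; field_simp
  have hcY := continuousOn_of_lipschitz_of_continuous (ε := ε) hg hgc hm hR hY hρ
  have hcgbar : ∀ {Z : ℝ → ℝ}, ContinuousOn Z (Set.Icc 0 T) → (∀ s ∈ Set.Icc 0 T, |Z s| ≤ ρ) →
      ContinuousOn (fun s => gbar (m s) (Z s)) (Set.Icc 0 T) := fun hZ hZρ =>
    continuousOn_of_lipschitz_of_continuous (g := fun r y _ => gbar r y) (ε := 1)
      (fun r r' y y' _ => hgbar r r' y y') (fun _ _ => continuous_const) hm hR hZ hZρ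
  have hii : ∀ {f : ℝ → ℝ}, ContinuousOn f (Set.Icc 0 T) → ∀ t ∈ Set.Icc 0 T,
      IntervalIntegrable f MeasureTheory.volume 0 t := fun hf t ht =>
    (hf.mono (Set.Icc_subset_Icc_right ht.2)).intervalIntegrable_of_Icc ht.1
  have hΓ0 : 0 ≤ Γ := (abs_nonneg _).trans (hΓ (m 0) 0 0 (hR 0 ⟨le_rfl, hT.le⟩))
  have hYosc : ∀ s ∈ Set.Icc 0 T, ∀ s' ∈ Set.Icc 0 T, s' ≤ s → |Y s - Y s'| ≤ Γ * (s - s') := by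
    intro s hs s' hs' hss
    rw [hYeq s hs, hYeq s' hs', add_sub_add_left_eq_sub,
      integral_interval_sub_left (hii hcY s hs) (hii hcY s' hs')]
    have h := norm_integral_le_of_norm_le_const (a := s') (b := s) (C := Γ)
      (f := fun w => g (m w) (Y w) (w / ε)) fun w hw => ?_
    · rwa [abs_of_nonneg (sub_nonneg.2 hss)] at h
    rw [Set.uIoc_of_le hss] at hw
    exact hΓ _ _ _ (hR w ⟨hs'.1.trans hw.1.le, hw.2.trans hs.2⟩)
  set I : ℝ := ∫ s in (0:ℝ)..T, |m s - m (⌊s / Δ⌋ * Δ)| with hI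
  have hIint := intervalIntegrable_abs_sub_floor hT.le hΔ hm hR
  have hfl : ∀ s ∈ Set.Icc 0 T, (⌊s / Δ⌋ : ℝ) * Δ ∈ Set.Icc 0 T := fun s hs =>
    ⟨(floor_div_mul_mem_Icc hΔ hs.1).2, (floor_div_mul_mem_Icc hΔ hs.1).1.2.trans hs.2⟩
  have hmesh : ∀ k < n, (k : ℝ) * Δ ∈ Set.Icc 0 T := fun k hk => by
    have : (k : ℝ) ≤ n := by exact_mod_cast hk.le
    exact ⟨by positivity, hnΔ ▸ (by gcongr)⟩
  have hfrozen := abs_integral_floor_le (c := ε * N)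
    (f := fun w s => g (m w) (Y w) (s / ε) - gbar (m w) (Y w)) hΔ n
    (fun k _ => ((hgc _ _).comp (continuous_id.div_const ε)).sub continuous_const)
    (fun k hk t ht => by
      have h := integral_comp_div (a := k * Δ) (b := t)
        (fun s => g (m (k * Δ)) (Y (k * Δ)) s - gbar (m (k * Δ)) (Y (k * Δ))) hε.ne'
      rw [h, smul_eq_mul, abs_mul, abs_of_pos hε]
      gcongr
      have h0 := (hmesh k hk).1
      exact hN _ _ _ _ (hR _ (hmesh k hk)) (by positivity) (by gcongr; exact ht.1))
  rw [hnΔ] at hfrozen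
  have hfluct : ∀ t ∈ Set.Icc 0 T,
      |∫ s in (0:ℝ)..t, (g (m s) (Y s) (s / ε) - gbar (m s) (Y s))| ≤
        2 * Λ * (I + Γ * Δ * T) + n * (ε * N) := by
    intro t ht
    obtain ⟨hf1, hf2⟩ := hfrozen t ht
    have hd1 : IntervalIntegrable (fun s => g (m s) (Y s) (s / ε) - gbar (m s) (Y s))
        MeasureTheory.volume 0 t := hii (hcY.sub (hcgbar hY hρ)) t ht
    have hIt : IntervalIntegrable (fun s => |m s - m (⌊s / Δ⌋ * Δ)|) MeasureTheory.volume 0 t :=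
      hIint.mono_set (by
        rw [Set.uIcc_of_le ht.1, Set.uIcc_of_le hT.le]; exact Set.Icc_subset_Icc_right ht.2)
    have hItle : ∫ s in (0:ℝ)..t, |m s - m (⌊s / Δ⌋ * Δ)| ≤ I :=
      integral_mono_interval le_rfl ht.1 ht.2 (Filter.Eventually.of_forall fun s => abs_nonneg _)
        hIint
    have hdiff : |∫ s in (0:ℝ)..t, ((g (m s) (Y s) (s / ε) - gbar (m s) (Y s)) -
        (g (m (⌊s / Δ⌋ * Δ)) (Y (⌊s / Δ⌋ * Δ)) (s / ε) -
          gbar (m (⌊s / Δ⌋ * Δ)) (Y (⌊s / Δ⌋ * Δ))))| ≤ 2 * Λ * (I + Γ * Δ * T) := by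
      have hb := norm_integral_le_of_norm_le (μ := MeasureTheory.volume)
        (f := fun s => (g (m s) (Y s) (s / ε) - gbar (m s) (Y s)) -
          (g (m (⌊s / Δ⌋ * Δ)) (Y (⌊s / Δ⌋ * Δ)) (s / ε) -
            gbar (m (⌊s / Δ⌋ * Δ)) (Y (⌊s / Δ⌋ * Δ))))
        (g := fun s => 2 * Λ * (|m s - m (⌊s / Δ⌋ * Δ)| + Γ * Δ)) ht.1
        (Filter.Eventually.of_forall fun s hs => by
          have hs' : s ∈ Set.Icc 0 T := ⟨hs.1.le, hs.2.trans ht.2⟩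
          have hsf := hfl s hs'
          have hsb := (floor_div_mul_mem_Icc hΔ hs'.1).1
          have hy : |Y s - Y (⌊s / Δ⌋ * Δ)| ≤ Γ * Δ :=
            (hYosc s hs' _ hsf hsb.2).trans (by gcongr; linarith [hsb.1])
          have h1 := hg _ _ _ _ (s / ε) (hR s hs') (hR _ hsf) (hρ s hs') (hρ _ hsf)
          have h2 := hgbar _ _ _ _ (hR s hs') (hR _ hsf) (hρ s hs') (hρ _ hsf)
          have h3 : Λ * (|m s - m (⌊s / Δ⌋ * Δ)| + |Y s - Y (⌊s / Δ⌋ * Δ)|) ≤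
            Λ * (|m s - m (⌊s / Δ⌋ * Δ)| + Γ * Δ) := by gcongr
          rw [sub_sub_sub_comm]
          refine (norm_sub_le _ _).trans ?_
          simp only [Real.norm_eq_abs]
          linarith)
        ((hIt.add intervalIntegrable_const).const_mul _)
      refine hb.trans ?_
      rw [integral_const_mul, integral_add hIt intervalIntegrable_const, integral_const,
        smul_eq_mul, sub_zero, mul_comm t]
      gcongr
      exact ht.2
    rw [integral_sub hd1 hf1] at hdiff
    have h := abs_add_le _ _ |>.trans (add_le_add hdiff hf2)
    rwa [sub_add_cancel] at h
  have hgron := le_mul_exp_of_le_add_mul_integral (φ := fun t => |Y t - Ybar t|)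
    (E := 2 * Λ * (I + Γ * Δ * T) + n * (ε * N)) hT.le hΛ (hY.sub hYbar).abs
    (fun _ _ => abs_nonneg _) (fun t ht => by
      have hsplit : Y t - Ybar t = (∫ s in (0:ℝ)..t, (g (m s) (Y s) (s / ε) - gbar (m s) (Y s))) +
          ∫ s in (0:ℝ)..t, (gbar (m s) (Y s) - gbar (m s) (Ybar s)) := by
        rw [integral_sub (hii hcY t ht) (hii (hcgbar hY hρ) t ht),
          integral_sub (hii (hcgbar hY hρ) t ht) (hii (hcgbar hYbar hρbar) t ht),
          hYeq t ht, hYbareq t ht]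
        ring
      rw [hsplit]
      refine (abs_add_le _ _).trans (add_le_add (hfluct t ht) ?_)
      rw [← integral_const_mul]
      refine norm_integral_le_of_norm_le (μ := MeasureTheory.volume)
        (f := fun s => gbar (m s) (Y s) - gbar (m s) (Ybar s))
        (g := fun s => Λ * |Y s - Ybar s|) ht.1 (Filter.Eventually.of_forall fun s hs => ?_)
        (hii (continuousOn_const.mul (hY.sub hYbar).abs) t ht)
      have hs' : s ∈ Set.Icc 0 T := ⟨hs.1.le, hs.2.trans ht.2⟩
      simpa using hgbar _ _ _ _ (hR s hs') (hR s hs') (hρ s hs') (hρbar s hs'))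
  refine (hgron t ht).trans ?_
  have hE : 0 ≤ 2 * Λ * (I + Γ * Δ * T) + n * (ε * N) :=
    (abs_nonneg _).trans (hfluct t ht)
  gcongr
  exact ht.2

lemma abs_exp_sub_exp_le {x y c : ℝ} (hx : x ≤ c) (hy : y ≤ c) :
    |Real.exp x - Real.exp y| ≤ Real.exp c * |x - y| :=
  Convex.norm_image_sub_le_of_norm_deriv_le (s := Set.Iic c)
    (fun _ _ => Real.differentiableAt_exp)
    (fun z hz => by simpa [Real.abs_exp] using hz) (convex_Iic c) hy hx

section Coefficients

variable {σ : ℝ → ℝ} {C₁ C₂ : ℝ} {F : ℝ × ℝ → ℝ}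

lemma abs_integral_deriv_flow_le (hC₁ : ∀ x, |deriv σ x| ≤ C₁) {r r' : ℝ} (x : ℝ) :
    |∫ s in r..r', deriv σ (F (s, x))| ≤ C₁ * |r' - r| :=
  norm_integral_le_of_norm_le_const (f := fun s => deriv σ (F (s, x))) fun _ _ => hC₁ _

/-- The flow is bounded on boxes. -/
lemma exists_abs_flow_le (hσ : Differentiable ℝ σ) (hC₁ : ∀ x, |deriv σ x| ≤ C₁)
    (hF0 : ∀ x : ℝ, F (0, x) = x)
    (hFr : ∀ r x : ℝ, HasDerivAt (fun r' : ℝ => F (r', x)) (σ (F (r, x))) r)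
    (hinj : ∀ r, Function.Injective fun x => F (r, x)) (R ρ : ℝ) :
    ∃ c, 0 < c ∧ ∀ r y, |r| ≤ R → |y| ≤ ρ → |F (r, y)| ≤ c := by
  have hC₁0 : 0 ≤ C₁ := (abs_nonneg _).trans (hC₁ 0)
  obtain ⟨c₀, hc₀⟩ := (isCompact_Icc (a := -R) (b := R)).exists_bound_of_continuousOn
    (flow_continuous hFr 0).continuousOn
  refine ⟨|c₀| + Real.exp (C₁ * R) * |ρ| + 1, by positivity, fun r y hr hy => ?_⟩
  have h1 := abs_flow_sub_le hσ hC₁ hF0 hFr hinj 0 y r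
  have h2 : |F (r, 0)| ≤ |c₀| := (hc₀ r (abs_le.1 hr)).trans (le_abs_self _)
  have hyρ : |y| ≤ |ρ| := hy.trans (le_abs_self ρ)
  have h3 : Real.exp (C₁ * |r|) * |y - 0| ≤ Real.exp (C₁ * R) * |ρ| := by
    rw [sub_zero]
    gcongr
  have h4 := abs_add_le (F (r, y) - F (r, 0)) (F (r, 0))
  rw [sub_add_cancel] at h4
  linarith

/-- The flow is Lipschitz on boxes. -/
lemma exists_abs_flow_sub_le (hσ : Differentiable ℝ σ) (hC₁ : ∀ x, |deriv σ x| ≤ C₁)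
    (hF0 : ∀ x : ℝ, F (0, x) = x)
    (hFr : ∀ r x : ℝ, HasDerivAt (fun r' : ℝ => F (r', x)) (σ (F (r, x))) r)
    (hinj : ∀ r, Function.Injective fun x => F (r, x)) (R ρ : ℝ) :
    ∃ Λ, 0 ≤ Λ ∧ ∀ r r' y y', |r| ≤ R → |r'| ≤ R → |y| ≤ ρ → |y'| ≤ ρ →
      |F (r, y) - F (r', y')| ≤ Λ * (|r - r'| + |y - y'|) := by
  have hC₁0 : 0 ≤ C₁ := (abs_nonneg _).trans (hC₁ 0)
  obtain ⟨c, -, hc⟩ := exists_abs_flow_le hσ hC₁ hF0 hFr hinj R ρ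
  obtain ⟨S, hS⟩ := (isCompact_Icc (a := -c) (b := c)).exists_bound_of_continuousOn
    hσ.continuous.continuousOn
  refine ⟨|S| + Real.exp (C₁ * R), by positivity, fun r r' y y' hr hr' hy hy' => ?_⟩
  have h1 : |F (r, y) - F (r', y)| ≤ |S| * |r - r'| :=
    Convex.norm_image_sub_le_of_norm_hasDerivWithin_le (s := Set.Icc (-R) R)
      (fun z _ => (hFr z y).hasDerivWithinAt)
      (fun z hz => (hS _ (abs_le.1 (hc z y (abs_le.2 hz) hy))).trans (le_abs_self S))
      (convex_Icc _ _) (abs_le.1 hr') (abs_le.1 hr)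
  have h2 : |F (r', y) - F (r', y')| ≤ Real.exp (C₁ * R) * |y - y'| :=
    (abs_flow_sub_le hσ hC₁ hF0 hFr hinj y' y r').trans (by gcongr)
  have h3 : 0 ≤ |S| * |y - y'| := by positivity
  have h4 : 0 ≤ Real.exp (C₁ * R) * |r - r'| := by positivity
  linarith [abs_sub_le (F (r, y)) (F (r', y)) (F (r', y'))]

/-- The reciprocal of the spatial derivative of the flow is Lipschitz on boxes. -/
lemma exists_abs_exp_integral_sub_le (hσ : ContDiff ℝ 2 σ) (hC₁ : ∀ x, |deriv σ x| ≤ C₁)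
    (hC₂ : ∀ x, |deriv (deriv σ) x| ≤ C₂) (hF0 : ∀ x : ℝ, F (0, x) = x)
    (hFr : ∀ r x : ℝ, HasDerivAt (fun r' : ℝ => F (r', x)) (σ (F (r, x))) r)
    (hinj : ∀ r, Function.Injective fun x => F (r, x)) (R : ℝ) :
    ∃ Λ, 0 ≤ Λ ∧ ∀ r r' y y', |r| ≤ R → |r'| ≤ R →
      |Real.exp (-∫ s in (0:ℝ)..r, deriv σ (F (s, y))) -
        Real.exp (-∫ s in (0:ℝ)..r', deriv σ (F (s, y')))| ≤ Λ * (|r - r'| + |y - y'|) := by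
  have hC₁0 : 0 ≤ C₁ := (abs_nonneg _).trans (hC₁ 0)
  have hC₂0 : 0 ≤ C₂ := (abs_nonneg _).trans (hC₂ 0)
  have hd : Differentiable ℝ σ := hσ.differentiable (by norm_num)
  have hσ' : ContDiff ℝ 1 (deriv σ) := (contDiff_succ_iff_deriv.1 hσ).2.2
  have hint : ∀ y r r', IntervalIntegrable (fun s => deriv σ (F (s, y)))
      MeasureTheory.volume r r' := fun y r r' =>
    (hσ'.continuous.comp (flow_continuous hFr y)).intervalIntegrable _ _
  refine ⟨Real.exp (C₁ * R) * (C₁ + C₂ * Real.exp (C₁ * R) * |R|), by positivity,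
    fun r r' y y' hr hr' => ?_⟩
  have hA : ∀ r y, |r| ≤ R → -∫ s in (0:ℝ)..r, deriv σ (F (s, y)) ≤ C₁ * R := by
    intro r y hr
    have h := abs_integral_deriv_flow_le (F := F) hC₁ (r := 0) (r' := r) y
    rw [sub_zero] at h
    exact (neg_le_abs _).trans (h.trans (by gcongr))
  have h1 : |(∫ s in (0:ℝ)..r', deriv σ (F (s, y))) - ∫ s in (0:ℝ)..r, deriv σ (F (s, y))| ≤
      C₁ * |r - r'| := by
    rw [integral_interval_sub_left (hint y _ _) (hint y _ _), abs_sub_comm r r']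
    exact abs_integral_deriv_flow_le hC₁ y
  have h2 : |(∫ s in (0:ℝ)..r', deriv σ (F (s, y'))) - ∫ s in (0:ℝ)..r', deriv σ (F (s, y))| ≤
      C₂ * Real.exp (C₁ * R) * |R| * |y - y'| := by
    rw [← integral_sub (hint y' _ _) (hint y _ _)]
    have h := norm_integral_le_of_norm_le_const (a := 0) (b := r')
      (C := C₂ * (Real.exp (C₁ * R) * |y - y'|))
      (f := fun s => deriv σ (F (s, y')) - deriv σ (F (s, y))) (fun s hs => by
        have hsr : |s| ≤ R := by
          have := Set.abs_sub_left_of_mem_uIcc (Set.uIoc_subset_uIcc hs)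
          simp only [sub_zero] at this
          exact this.trans hr'
        refine (abs_sub_le_of_abs_deriv_le (hσ'.differentiable one_ne_zero) hC₂ _ _).trans ?_
        gcongr
        refine (abs_flow_sub_le hd hC₁ hF0 hFr hinj y y' s).trans ?_
        rw [abs_sub_comm y' y]
        gcongr)
    rw [sub_zero] at h
    refine h.trans ?_
    rw [show C₂ * Real.exp (C₁ * R) * |R| * |y - y'| =
      C₂ * (Real.exp (C₁ * R) * |y - y'|) * |R| by ring]
    have hrR : |r'| ≤ |R| := hr'.trans (le_abs_self R)
    gcongr
  refine (abs_exp_sub_exp_le (hA r y hr) (hA r' y' hr')).trans ?_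
  rw [mul_assoc]
  gcongr
  rw [neg_sub_neg]
  have h3 : 0 ≤ C₁ * |y - y'| := by positivity
  have h4 : 0 ≤ C₂ * Real.exp (C₁ * R) * |R| * |r - r'| := by positivity
  linarith [abs_sub_le (∫ s in (0:ℝ)..r', deriv σ (F (s, y')))
    (∫ s in (0:ℝ)..r', deriv σ (F (s, y))) (∫ s in (0:ℝ)..r, deriv σ (F (s, y)))]

end Coefficients

lemma abs_mul_sub_mul_le {a a' x x' A X d e : ℝ} (ha' : |a'| ≤ A) (hx : |x| ≤ X)
    (hd : |a - a'| ≤ d) (he : |x - x'| ≤ e) : |a * x - a' * x'| ≤ d * X + A * e := by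
  rw [show a * x - a' * x' = (a - a') * x + a' * (x - x') by ring]
  refine (abs_add_le _ _).trans ?_
  rw [abs_mul, abs_mul]
  have := (abs_nonneg _).trans hd
  have := (abs_nonneg _).trans ha'
  gcongr

/-- A bound for all values of `f` is a bound for its long-time average. -/
lemma abs_le_of_tendsto_average {f : ℝ → ℝ} {l C : ℝ}
    (hl : Filter.Tendsto (fun t : ℝ => (1 / t) * ∫ s in (0:ℝ)..t, f s) Filter.atTop (nhds l))
    (hC : ∀ s, |f s| ≤ C) : |l| ≤ C := by
  refine le_of_tendsto hl.abs ?_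
  filter_upwards [Filter.eventually_gt_atTop 0] with t ht
  have h := norm_integral_le_of_norm_le_const (a := 0) (b := t) (f := f) fun s _ => hC s
  rw [Real.norm_eq_abs, sub_zero, abs_of_pos ht] at h
  rw [abs_mul, abs_of_pos (by positivity : 0 < 1 / t), one_div, inv_mul_le_iff₀ ht, mul_comm]
  exact h

/-- The long-time average is monotone with respect to uniform bounds on differences. -/
lemma abs_average_sub_le {f g : ℝ → ℝ} {l l' C : ℝ} (hf : Continuous f) (hg : Continuous g)
    (hl : Filter.Tendsto (fun t : ℝ => (1 / t) * ∫ s in (0:ℝ)..t, f s) Filter.atTop (nhds l))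
    (hl' : Filter.Tendsto (fun t : ℝ => (1 / t) * ∫ s in (0:ℝ)..t, g s) Filter.atTop (nhds l'))
    (hC : ∀ s, |f s - g s| ≤ C) : |l - l'| ≤ C := by
  refine abs_le_of_tendsto_average (f := fun s => f s - g s) ((hl.sub hl').congr fun t => ?_) hC
  rw [integral_sub (hf.intervalIntegrable _ _) (hg.intervalIntegrable _ _), mul_sub]

/-- There exists a constant `K` (depending only on `σ`, `b`, `T`, the
path `m` and `x₀`) such that for every `ε ∈ (0, 1]` and every integer `n ≥ 1`, setting
`Δ := T/n`, one has
`sup_{t ∈ [0,T]} |X^ε t − X̄ t| ≤ K (n ε + 1/n + ∫₀^T |m s − m (⌊s/Δ⌋ Δ)| ds)`,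
where `X^ε t = F (m t, Y^ε t)` and `X̄ t = F (m t, Ȳ t)` with `Ȳ` the solution of the
averaged equation. -/
theorem averaging_quantitative_error_bound
    (σ : ℝ → ℝ) (hσ : ContDiff ℝ 2 σ)
    (C₁ : ℝ) (hC₁ : ∀ x, |deriv σ x| ≤ C₁)
    (C₂ : ℝ) (hC₂ : ∀ x, |deriv (deriv σ) x| ≤ C₂)
    (F H : ℝ × ℝ → ℝ)
    (hF0 : ∀ x : ℝ, F (0, x) = x)
    (hFr : ∀ r x : ℝ, HasDerivAt (fun r' : ℝ => F (r', x)) (σ (F (r, x))) r)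
    (hH : ∀ r : ℝ, Function.LeftInverse (fun y : ℝ => H (r, y)) (fun x : ℝ => F (r, x)) ∧
      Function.RightInverse (fun y : ℝ => H (r, y)) (fun x : ℝ => F (r, x)))
    (b : ℝ × ℝ → ℝ) (hbc : Continuous b)
    (B : ℝ) (hB : ∀ p, |b p| ≤ B)
    (L : ℝ → ℝ)
    (hbL : ∀ c : ℝ, 0 < c → ∀ x y t : ℝ, |x| ≤ c → |y| ≤ c →
      |b (x, t) - b (y, t)| ≤ L c * |x - y|)
    (T : ℝ) (hT : 0 < T)
    (m : ℝ → ℝ) (hm : ContinuousOn m (Set.Icc 0 T)) (hm0 : m 0 = 0)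
    (x₀ : ℝ)
    (bbar : ℝ → ℝ)
    (hbar : ∀ y : ℝ, Filter.Tendsto (fun t : ℝ => (1 / t) * ∫ s in (0:ℝ)..t, b (y, s))
      Filter.atTop (nhds (bbar y)))
    (M : ℝ)
    (hG : ∀ y : ℝ, ∀ r : ℝ, 0 ≤ r → |∫ s in (0:ℝ)..r, (b (y, s) - bbar y)| ≤ M)
    :
    ∃ K : ℝ, ∀ ε : ℝ, 0 < ε → ε ≤ 1 → ∀ n : ℕ, 1 ≤ n →
      ∀ Y Ybar : ℝ → ℝ, SolvesAveragingODE F H b m T x₀ ε Y →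
        SolvesAveragingODE F H (fun p : ℝ × ℝ => bbar p.1) m T x₀ 1 Ybar →
        ∀ t ∈ Set.Icc (0:ℝ) T,
          |F (m t, Y t) - F (m t, Ybar t)| ≤
            K * ((n : ℝ) * ε + 1 / (n : ℝ) +
              ∫ s in (0:ℝ)..T, |m s - m ((⌊s / (T / (n : ℝ))⌋ : ℝ) * (T / (n : ℝ)))|) := by
  have hd : Differentiable ℝ σ := hσ.differentiable (by norm_num)
  have hinj : ∀ r, Function.Injective fun x => F (r, x) := fun r => (hH r).1.injective
  have hC₁0 : 0 ≤ C₁ := (abs_nonneg _).trans (hC₁ 0)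
  have hB0 : 0 ≤ B := (abs_nonneg _).trans (hB 0)
  have hM0 : 0 ≤ M := (abs_nonneg _).trans (hG 0 0 le_rfl)
  have hbx : ∀ x, Continuous fun s => b (x, s) := fun x => by fun_prop
  have hbbarB : ∀ x, |bbar x| ≤ B := fun x => abs_le_of_tendsto_average (hbar x) fun s => hB _
  obtain ⟨R, hR⟩ := isCompact_Icc.exists_bound_of_continuousOn hm
  set E : ℝ := Real.exp (C₁ * R) with hE
  have hE0 : 0 < E := Real.exp_pos _
  set a : ℝ → ℝ → ℝ := fun r y => Real.exp (-∫ s in (0:ℝ)..r, deriv σ (F (s, y))) with ha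
  have haE : ∀ r y, |r| ≤ R → |a r y| ≤ E := by
    intro r y hr
    have h := abs_integral_deriv_flow_le (F := F) hC₁ (r := 0) (r' := r) y
    rw [sub_zero] at h
    rw [ha, Real.abs_exp]
    exact Real.exp_le_exp.2 ((neg_le_abs _).trans (h.trans (by gcongr)))
  have hderiv : ∀ r y, deriv (fun z => H (r, z)) (F (r, y)) = a r y :=
    deriv_inverse_flow hσ hC₁ hC₂ hF0 hFr hH
  set ρ : ℝ := |H (0, x₀)| + E * B * T with hρ
  have hbound : ∀ (β : ℝ × ℝ → ℝ), (∀ p, |β p| ≤ B) → ∀ ε Z, SolvesAveragingODE F H β m T x₀ ε Z →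
      ∀ s ∈ Set.Icc 0 T, |Z s| ≤ ρ := by
    intro β hβ ε Z hZ s hs
    rw [hZ.2 s hs]
    refine (abs_add_le _ _).trans (add_le_add_right ?_ _)
    have h := norm_integral_le_of_norm_le_const (a := 0) (b := s) (C := E * B)
      (f := fun s => deriv (fun y : ℝ => H (m s, y)) (F (m s, Z s)) * β (F (m s, Z s), s / ε))
      (fun w hw => by
        rw [Set.uIoc_of_le hs.1] at hw
        rw [hderiv, norm_mul]
        exact mul_le_mul (haE _ _ (hR w ⟨hw.1.le, hw.2.trans hs.2⟩)) (hβ _) (abs_nonneg _) hE0.le)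
    rw [sub_zero, abs_of_nonneg hs.1] at h
    refine h.trans ?_
    gcongr
    exact hs.2
  obtain ⟨c, hc0, hc⟩ := exists_abs_flow_le hd hC₁ hF0 hFr hinj R ρ
  obtain ⟨ΛF, hΛF0, hΛF⟩ := exists_abs_flow_sub_le hd hC₁ hF0 hFr hinj R ρ
  obtain ⟨Λa, hΛa0, hΛa⟩ := exists_abs_exp_integral_sub_le hσ hC₁ hC₂ hF0 hFr hinj R
  have hbbarL : ∀ x y, |x| ≤ c → |y| ≤ c → |bbar x - bbar y| ≤ L c * |x - y| := fun x y hx hy =>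
    abs_average_sub_le (hbx x) (hbx y) (hbar x) (hbar y) fun s => hbL c hc0 x y s hx hy
  have hLc : ∀ x y : ℝ, L c * |x - y| ≤ |L c| * |x - y| := fun x y => by
    gcongr
    exact le_abs_self _
  set Λ : ℝ := Λa * B + E * (|L c| * ΛF) + 1 with hΛdef
  have hΛ : 0 < Λ := by positivity
  have hcoef : ∀ β : ℝ → ℝ, (∀ x, |β x| ≤ B) →
      (∀ x y, |x| ≤ c → |y| ≤ c → |β x - β y| ≤ L c * |x - y|) →
      ∀ r r' y y', |r| ≤ R → |r'| ≤ R → |y| ≤ ρ → |y'| ≤ ρ →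
      |a r y * β (F (r, y)) - a r' y' * β (F (r', y'))| ≤ Λ * (|r - r'| + |y - y'|) := by
    intro β hβ hβL r r' y y' hr hr' hy hy'
    have h1 := (hβL _ _ (hc r y hr hy) (hc r' y' hr' hy')).trans (hLc _ _)
    have h2 := h1.trans (mul_le_mul_of_nonneg_left (hΛF r r' y y' hr hr' hy hy') (abs_nonneg _))
    refine (abs_mul_sub_mul_le (haE r' y' hr') (hβ _) (hΛa r r' y y' hr hr') h2).trans ?_
    have h3 : 0 ≤ |r - r'| + |y - y'| := by positivity
    rw [hΛdef]
    linarith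
  refine ⟨E * ((2 * Λ + 2 * Λ * (E * B) * T ^ 2 + E * (2 * M)) * Real.exp (Λ * T)), ?_⟩
  intro ε hε _ n hn Y Ybar hY hYbar t ht
  have hn0 : (0 : ℝ) < n := by exact_mod_cast hn
  have hρY := hbound b hB ε Y hY
  have hρYbar := hbound _ (fun p => hbbarB p.1) 1 Ybar hYbar
  have hmain := averaging_estimate (g := fun r y τ => a r y * b (F (r, y), τ))
    (gbar := fun r y => a r y * bbar (F (r, y))) (Γ := E * B) (N := E * (2 * M))
    (y₀ := H (0, x₀)) hT hε hΛ
    (fun r r' y y' τ => hcoef (fun x => b (x, τ)) (fun x => hB _)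
      (fun x y hx hy => hbL c hc0 x y τ hx hy) r r' y y')
    (hcoef bbar hbbarB hbbarL)
    (fun r y => continuous_const.mul (hbx _))
    (fun r y τ hr => by
      rw [abs_mul]
      exact mul_le_mul (haE r y hr) (hB _) (abs_nonneg _) hE0.le)
    (fun r y u v hr hu huv => by
      have hi : ∀ p q, IntervalIntegrable (fun s => b (F (r, y), s) - bbar (F (r, y)))
          MeasureTheory.volume p q := fun p q =>
        ((hbx _).sub continuous_const).intervalIntegrable p q
      simp only [← mul_sub]
      rw [integral_const_mul, abs_mul, ← integral_interval_sub_left (hi 0 v) (hi 0 u)]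
      refine mul_le_mul (haE r y hr) ?_ (abs_nonneg _) hE0.le
      refine (abs_sub _ _).trans ?_
      linarith [hG (F (r, y)) v (hu.trans huv), hG (F (r, y)) u hu])
    hm hR hY.1 hρY hYbar.1 hρYbar
    (fun s hs => by simpa only [hderiv] using hY.2 s hs)
    (fun s hs => by simpa only [hderiv] using hYbar.2 s hs) hn ht
  set I : ℝ := ∫ s in (0:ℝ)..T, |m s - m ((⌊s / (T / (n : ℝ))⌋ : ℝ) * (T / (n : ℝ)))| with hI
  have hI0 : 0 ≤ I := integral_nonneg hT.le fun _ _ => abs_nonneg _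
  have hrm : |m t| ≤ R := hR t ht
  refine (abs_flow_sub_le hd hC₁ hF0 hFr hinj (Ybar t) (Y t) (m t)).trans ?_
  have h1 : Real.exp (C₁ * |m t|) ≤ E := Real.exp_le_exp.2 (by gcongr)
  refine (mul_le_mul h1 hmain (abs_nonneg _) hE0.le).trans ?_
  rw [mul_assoc E (_ * Real.exp _)]
  gcongr E * ?_
  rw [mul_right_comm _ (Real.exp _)]
  gcongr ?_ * _
  have e1 : 2 * Λ * (I + E * B * (T / n) * T) + n * (ε * (E * (2 * M))) =
    2 * Λ * I + 2 * Λ * (E * B) * T ^ 2 * (1 / n) + E * (2 * M) * (n * ε) := by ring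
  rw [e1]
  set P : ℝ := 2 * Λ
  set Q : ℝ := 2 * Λ * (E * B) * T ^ 2
  set S : ℝ := E * (2 * M)
  have hP : 0 ≤ P := by positivity
  have hQ : 0 ≤ Q := by positivity
  have hS : 0 ≤ S := by positivity
  have hx : (0 : ℝ) ≤ n * ε := by positivity
  have hy : (0 : ℝ) ≤ 1 / n := by positivity
  generalize (n : ℝ) * ε = x at *
  generalize (1 : ℝ) / n = y at *
  nlinarith [mul_nonneg hP hx, mul_nonneg hP hy, mul_nonneg hQ hx, mul_nonneg hQ hI0,
    mul_nonneg hS hy, mul_nonneg hS hI0]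
end
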